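/- For every N ≥ 1, the smallest eigenvalue of the matrix T = B_N + diag(1, 0, …, 0, 1) satisfies λ_min(T) ≤ 2(1 − cos(π/(N+1))) + 4 sin²(π/(N+1))/(N+1). -/

import Mathlib

open Matrix

/-- The set of (real) eigenvalues of a square matrix `M`. -/
noncomputable def eigSet {N : ℕ} (M : Matrix (Fin N) (Fin N) ℝ) : Set ℝ :=
  {μ : ℝ | ∃ v : Fin N → ℝ, v ≠ 0 ∧ M.mulVec v = μ • v}

/-- The smallest eigenvalue of a matrix with real eigenvalues. -/
noncomputable def lamMin {N : ℕ} (M : Matrix (Fin N) (Fin N) ℝ) : ℝ :=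
  sInf (eigSet M)

/-- The `N×N` tridiagonal matrix with all diagonal entries `2` and `−1` on the
sub- and superdiagonal. -/
noncomputable def matB (N : ℕ) : Matrix (Fin N) (Fin N) ℝ := fun i j =>
  if (i : ℕ) = (j : ℕ) then 2
  else if (i : ℕ) + 1 = (j : ℕ) ∨ (j : ℕ) + 1 = (i : ℕ) then -1 else 0

/-- The `N×N` diagonal matrix `diag(1, 0, …, 0, 1)`. -/
noncomputable def matC (N : ℕ) : Matrix (Fin N) (Fin N) ℝ :=
  Matrix.diagonal (fun i : Fin N => if (i : ℕ) = 0 ∨ (i : ℕ) = N - 1 then 1 else 0)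

lemma matB_isHermitian (N : ℕ) : (matB N).IsHermitian := by
  ext i j
  simp only [conjTranspose_apply, matB, star_trivial]
  grind

lemma matC_isHermitian (N : ℕ) : (matC N).IsHermitian :=
  isHermitian_diagonal _

lemma eigSet_finite {N : ℕ} (M : Matrix (Fin N) (Fin N) ℝ) : (eigSet M).Finite := by
  refine (Module.End.finite_hasEigenvalue (Matrix.toLin' M)).subset ?_
  rintro μ ⟨v, hv, h⟩
  exact Module.End.hasEigenvalue_of_hasEigenvector
    (x := v) ⟨Module.End.mem_eigenspace_iff.2 (by simpa using h), hv⟩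

/-- Rayleigh's principle: the smallest eigenvalue is at most any Rayleigh quotient. -/
lemma lamMin_le_of_dotProduct_mulVec_le {N : ℕ} {M : Matrix (Fin N) (Fin N) ℝ}
    (hM : M.IsHermitian) {v : Fin N → ℝ} (hv : v ≠ 0) {r : ℝ}
    (h : v ⬝ᵥ M *ᵥ v ≤ r * (v ⬝ᵥ v)) : lamMin M ≤ r := by
  have hA : (M - r • (1 : Matrix (Fin N) (Fin N) ℝ)).IsHermitian :=
    hM.sub (by simp [IsHermitian])
  obtain ⟨i, hi⟩ : ∃ i, hA.eigenvalues i ≤ 0 := by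
    by_contra! hpos
    have hlt := (hA.posDef_iff_eigenvalues_pos.2 hpos).dotProduct_mulVec_pos hv
    simp only [star_trivial, sub_mulVec, smul_mulVec, one_mulVec, dotProduct_sub,
      dotProduct_smul, smul_eq_mul] at hlt
    linarith
  have hmem : hA.eigenvalues i + r ∈ eigSet M := by
    refine ⟨(hA.eigenvectorBasis i).ofLp, fun h0 => ?_, ?_⟩
    · exact hA.eigenvectorBasis.orthonormal.ne_zero i (by ext j; simp [h0])
    · have := hA.mulVec_eigenvectorBasis i
      rw [sub_mulVec, smul_mulVec, one_mulVec, sub_eq_iff_eq_add] at this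
      rw [this, add_smul]
  exact (csInf_le (eigSet_finite M).bddBelow hmem).trans (by linarith)

lemma matB_mulVec_apply {N : ℕ} {g : ℕ → ℝ} (h0 : g 0 = 0) (hN : g (N + 1) = 0) (i : Fin N) :
    (matB N *ᵥ fun j => g (j + 1)) i = 2 * g (i + 1) - g i - g (i + 2) := by
  have hi := i.2
  let F : ℕ → ℝ := fun k => (if k = i then 2 * g (k + 1) else 0)
    - (if k = i + 1 then g (k + 1) else 0) - (if k + 1 = i then g (k + 1) else 0)
  have hsplit : ∀ j : Fin N, matB N i j * g (j + 1) = F j := by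
    intro j
    simp only [matB, F]
    grind
  have hlow : ∑ k ∈ Finset.range N, (if k + 1 = (i : ℕ) then g (k + 1) else 0) = g i := by
    rcases hc : (i : ℕ) with _ | m
    · simp [h0]
    · simp only [Nat.add_right_cancel_iff, Finset.sum_ite_eq', Finset.mem_range]
      rw [if_pos (by omega)]
  simp only [mulVec, dotProduct]
  rw [Finset.sum_congr rfl fun j _ => hsplit j, Fin.sum_univ_eq_sum_range F,
    Finset.sum_sub_distrib, Finset.sum_sub_distrib, hlow]
  simp only [Finset.sum_ite_eq', Finset.mem_range, if_pos hi]
  split_ifs with hlt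
  · ring
  · have : (i : ℕ) + 2 = N + 1 := by omega
    rw [this, hN]
    ring

lemma four_mul_sin_mul_sum_sin_sq (a : ℝ) (n : ℕ) :
    4 * Real.sin a * ∑ j ∈ Finset.range n, Real.sin ((j + 1 : ℕ) * a) ^ 2
      = (2 * n + 1) * Real.sin a - Real.sin ((2 * n + 1) * a) := by
  induction n with
  | zero => simp
  | succ n ih =>
    rw [Finset.sum_range_succ, mul_add, ih]
    push_cast
    have h1 : (2 * (n : ℝ) + 1) * a = 2 * ((n + 1) * a) - a := by ring
    have h2 : (2 * ((n : ℝ) + 1) + 1) * a = 2 * ((n + 1) * a) + a := by ring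
    rw [h1, h2, Real.sin_sub, Real.sin_add, Real.cos_two_mul, Real.cos_sq']
    ring

lemma sum_sin_sq_eq {N : ℕ} (hN : 1 ≤ N) :
    ∑ j ∈ Finset.range N, Real.sin ((j + 1 : ℕ) * (Real.pi / (N + 1))) ^ 2 = (N + 1) / 2 := by
  have hN' : (1 : ℝ) ≤ N := by exact_mod_cast hN
  have hsin : 0 < Real.sin (Real.pi / (N + 1)) :=
    Real.sin_pos_of_pos_of_lt_pi (by positivity) (div_lt_self Real.pi_pos (by linarith))
  have h := four_mul_sin_mul_sum_sin_sq (Real.pi / (N + 1)) N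
  have harg : (2 * (N : ℝ) + 1) * (Real.pi / (N + 1)) = 2 * Real.pi - Real.pi / (N + 1) := by
    field_simp
    ring
  rw [harg, Real.sin_two_pi_sub] at h
  refine mul_left_cancel₀ (mul_pos four_pos hsin).ne' (h.trans ?_)
  ring

lemma dotProduct_matC_mulVec_le {N : ℕ} (hN : 1 ≤ N) (g : ℕ → ℝ) :
    (fun j : Fin N => g (j + 1)) ⬝ᵥ (matC N *ᵥ fun j => g (j + 1)) ≤ g 1 ^ 2 + g N ^ 2 := by
  let F : ℕ → ℝ := fun k =>
    (if k = 0 then g (k + 1) ^ 2 else 0) + (if k = N - 1 then g (k + 1) ^ 2 else 0)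
  have hle : ∀ j : Fin N, g (j + 1) * (matC N *ᵥ fun j => g (j + 1)) j ≤ F j := by
    intro j
    have := sq_nonneg (g (j + 1))
    simp only [matC, mulVec_diagonal, F]
    split_ifs <;> first | nlinarith | simp_all
  refine (Finset.sum_le_sum fun j _ => hle j).trans ?_
  rw [Fin.sum_univ_eq_sum_range F, Finset.sum_add_distrib]
  simp only [Finset.sum_ite_eq', Finset.mem_range]
  rw [if_pos (by omega), if_pos (by omega), Nat.sub_add_cancel hN]

theorem stmt_13 (N : ℕ) (hN : 1 ≤ N) :
    lamMin (matB N + matC N)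
      ≤ 2 * (1 - Real.cos (Real.pi / (N + 1)))
        + 4 * Real.sin (Real.pi / (N + 1)) ^ 2 / (N + 1) := by
  have hpos : (0 : ℝ) < N + 1 := by positivity
  have hsum := sum_sin_sq_eq hN
  have hNa : (N + 1 : ℝ) * (Real.pi / (N + 1)) = Real.pi := by field_simp
  set a := Real.pi / (N + 1 : ℝ)
  let g : ℕ → ℝ := fun k => Real.sin (k * a)
  let v : Fin N → ℝ := fun j => g (j + 1)
  have hvv : v ⬝ᵥ v = (N + 1) / 2 := by
    rw [← hsum, ← Fin.sum_univ_eq_sum_range fun k : ℕ => Real.sin ((k + 1 : ℕ) * a) ^ 2]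
    exact Finset.sum_congr rfl fun j _ => (sq _).symm
  have hv : v ≠ 0 := by
    intro h
    rw [h, zero_dotProduct] at hvv
    linarith
  have hB : matB N *ᵥ v = (2 * (1 - Real.cos a)) • v := by
    ext i
    rw [matB_mulVec_apply (g := g) (by simp [g]) (by simp [g, hNa])]
    have h1 : (i : ℝ) * a = (i + 1) * a - a := by ring
    have h2 : ((i : ℝ) + 2) * a = (i + 1) * a + a := by ring
    simp only [g, v, Pi.smul_apply, smul_eq_mul, Nat.cast_add, Nat.cast_one, Nat.cast_ofNat]
    rw [h1, h2, Real.sin_sub, Real.sin_add]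
    ring
  have hC : v ⬝ᵥ matC N *ᵥ v ≤ 2 * Real.sin a ^ 2 := by
    refine (dotProduct_matC_mulVec_le hN g).trans_eq ?_
    have hlast : (N : ℝ) * a = Real.pi - a := by linarith
    simp only [g, Nat.cast_one, one_mul, hlast, Real.sin_pi_sub]
    ring
  refine lamMin_le_of_dotProduct_mulVec_le
    ((matB_isHermitian N).add (matC_isHermitian N)) hv ?_
  rw [add_mulVec, dotProduct_add, hB, dotProduct_smul, smul_eq_mul, add_mul]
  have : 4 * Real.sin a ^ 2 / (N + 1) * (v ⬝ᵥ v) = 2 * Real.sin a ^ 2 := by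
    rw [hvv]
    field_simp
    ring
  linarith
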